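/- arXiv:2112.03228 — 2 statements merged into one kernel-verified Lean document; each statement's English description precedes it below -/
import Mathlib

section
/- In the coupling of the Loop O(1) model with FK-Ising: conditionally on η' = ω', the configuration η is uniformly distributed over all even subgraphs of ω'. In particular, the number of even subgraphs contained in any fixed edge set ω' ⊆ E with k(ω') components is 2^{|ω'| - |V| + k(ω')}. -/
open scoped BigOperators

lemma aux_weight {α : Type*} [DecidableEq α] (E ω η : Finset α) (x : ℝ) (hω : ω ⊆ E)
    (hη : η ⊆ ω) :
    (∑ X ∈ E.powerset, (if η ∪ X = ω then
            x ^ η.card * (x ^ X.card * (1 - x) ^ (E.card - X.card)) else 0))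
      = x ^ ω.card * (1 - x) ^ (E.card - ω.card) := by
  have h1 : ∑ t ∈ η.powerset, x ^ t.card * (1 - x) ^ (η.card - t.card) = 1 := by
    rw [Finset.sum_pow_mul_eq_add_pow]; simp
  rw [← Finset.sum_filter]
  symm
  have h2 : x ^ ω.card * (1 - x) ^ (E.card - ω.card) = ∑ t ∈ η.powerset,
      x ^ ω.card * (1 - x) ^ (E.card - ω.card) * (x ^ t.card * (1 - x) ^ (η.card - t.card)) := by
    rw [← Finset.mul_sum, h1, mul_one]
  rw [h2]
  refine Finset.sum_bij (fun S _ => (ω \ η) ∪ S) ?_ ?_ ?_ ?_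
  · intro S hS
    rw [Finset.mem_powerset] at hS
    rw [Finset.mem_filter, Finset.mem_powerset]
    constructor
    · intro a ha; grind
    · ext a; grind
  · intro S hS T hT h
    rw [Finset.mem_powerset] at hS hT
    ext a
    have := Finset.ext_iff.1 h a
    grind
  · intro X hX
    rw [Finset.mem_filter, Finset.mem_powerset] at hX
    refine ⟨X ∩ η, by simp, ?_⟩
    obtain ⟨_, h⟩ := hX
    ext a
    have := Finset.ext_iff.1 h a
    grind
  · intro S hS
    rw [Finset.mem_powerset] at hS
    have hd : Disjoint (ω \ η) S := by
      rw [Finset.disjoint_left]; grind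
    have c1 := Finset.card_union_of_disjoint hd
    have c2 := Finset.card_sdiff_add_card_eq_card hη
    have c3 := Finset.card_le_card hS
    have c4 := Finset.card_le_card hω
    have e1 : E.card - (ω \ η ∪ S).card = (E.card - ω.card) + (η.card - S.card) := by omega
    rw [e1, c1, ← c2, pow_add, pow_add, pow_add]
    ring

/-- Incidence matrix of an edge set over `ZMod 2`. -/
def incM {V : Type*} [DecidableEq V] (ω : Finset (Sym2 V)) : Matrix V ω (ZMod 2) :=
  fun v e => if v ∈ e.1 then 1 else 0

lemma aux_ker_transpose {V : Type*} [Fintype V] [DecidableEq V] (ω : Finset (Sym2 V))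
    (hω : ∀ e ∈ ω, ¬ e.IsDiag) :
    Module.finrank (ZMod 2) (LinearMap.ker (incM ω).transpose.mulVecLin) =
      Nat.card (SimpleGraph.fromEdgeSet (↑ω : Set (Sym2 V))).ConnectedComponent := by
  classical
  set H := SimpleGraph.fromEdgeSet (↑ω : Set (Sym2 V)) with hH
  have hinj : Function.Injective
      (LinearMap.funLeft (ZMod 2) (ZMod 2) H.connectedComponentMk) :=
    LinearMap.funLeft_injective_of_surjective _ _ _ Quot.mk_surjective
  have key : ∀ (g : V → ZMod 2) (a b : V) (hab : s(a, b) ∈ ω),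
      ((incM ω).transpose.mulVec g) ⟨s(a, b), hab⟩ = g a + g b := by
    intro g a b hab
    have hne : a ≠ b := fun h => hω _ hab (by simpa using h)
    simp only [Matrix.mulVec, dotProduct, Matrix.transpose_apply, incM, Sym2.mem_iff, ite_mul,
      one_mul, zero_mul]
    rw [← Finset.sum_filter, ← Finset.sum_pair hne]
    congr 1
    ext v; simp
  have hk : LinearMap.ker (incM ω).transpose.mulVecLin =
      LinearMap.range (LinearMap.funLeft (ZMod 2) (ZMod 2) H.connectedComponentMk) := by
    ext g
    rw [LinearMap.mem_ker, LinearMap.mem_range, Matrix.mulVecLin_apply]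
    constructor
    · intro hg
      have hadj : ∀ a b, H.Adj a b → g a = g b := by
        intro a b h
        rw [hH, SimpleGraph.fromEdgeSet_adj] at h
        have hm : s(a, b) ∈ ω := by exact_mod_cast h.1
        have := key g a b hm
        rw [hg, Pi.zero_apply] at this
        exact CharTwo.add_eq_zero.1 this.symm
      have hreach : ∀ a b, H.Reachable a b → g a = g b := by
        rintro a b ⟨w⟩
        induction w with
        | nil => rfl
        | cons h _ ih => exact (hadj _ _ h).trans ih
      refine ⟨fun c => g c.out, ?_⟩
      ext v
      rw [LinearMap.funLeft_apply]
      apply hreach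
      exact SimpleGraph.ConnectedComponent.exact (Quot.out_eq _)
    · rintro ⟨f, rfl⟩
      ext ⟨e, he⟩
      induction e with
      | _ a b =>
        rw [key, Pi.zero_apply, CharTwo.add_eq_zero, LinearMap.funLeft_apply,
          LinearMap.funLeft_apply]
        have hne : a ≠ b := fun h => hω _ he (by simpa using h)
        congr 1
        apply SimpleGraph.ConnectedComponent.sound
        apply SimpleGraph.Adj.reachable
        rw [hH, SimpleGraph.fromEdgeSet_adj]
        exact ⟨by exact_mod_cast he, hne⟩
  rw [hk, LinearMap.finrank_range_of_inj hinj, Module.finrank_fintype_fun_eq_card,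
    Nat.card_eq_fintype_card]

lemma aux_ker {V : Type*} [Fintype V] [DecidableEq V] (ω : Finset (Sym2 V))
    (hω : ∀ e ∈ ω, ¬ e.IsDiag) :
    Module.finrank (ZMod 2) (LinearMap.ker (incM ω).mulVecLin) = ω.card +
      Nat.card (SimpleGraph.fromEdgeSet (↑ω : Set (Sym2 V))).ConnectedComponent
        - Fintype.card V := by
  have h1 := LinearMap.finrank_range_add_finrank_ker (incM ω).mulVecLin
  have h2 := LinearMap.finrank_range_add_finrank_ker (incM ω).transpose.mulVecLin
  have h3 := Matrix.rank_transpose (incM ω)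
  rw [aux_ker_transpose ω hω] at h2
  simp only [Matrix.rank] at h3
  rw [Module.finrank_fintype_fun_eq_card] at h1 h2
  rw [Fintype.card_coe] at h1
  omega

lemma aux_card {V : Type*} [Fintype V] [DecidableEq V] (ω : Finset (Sym2 V)) :
    (ω.powerset.filter
          (fun η => ∀ v : V, Even ((η.filter fun e => v ∈ e).card))).card =
      Nat.card (LinearMap.ker (incM ω).mulVecLin) := by
  classical
  have key : ∀ η ⊆ ω, ∀ v : V, (incM ω).mulVec (fun e => if e.1 ∈ η then 1 else 0) v
      = ((η.filter fun e => v ∈ e).card : ZMod 2) := by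
    intro η hη v
    simp only [Matrix.mulVec, dotProduct, incM]
    rw [Finset.sum_coe_sort ω
      (fun e => (if v ∈ e then (1 : ZMod 2) else 0) * (if e ∈ η then 1 else 0))]
    rw [Finset.card_filter, Nat.cast_sum, ← Finset.sum_subset hη]
    · apply Finset.sum_congr rfl
      intro e he
      simp [he]
    · intro e _ he
      simp [he]
  have : Nat.card (LinearMap.ker (incM ω).mulVecLin) =
      (Finset.univ.filter (fun f : ω → ZMod 2 => (incM ω).mulVec f = 0)).card := by
    rw [← Fintype.card_subtype, ← Nat.card_eq_fintype_card]
    rfl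
  rw [this]
  refine Finset.card_bij (fun η _ => fun e => if e.1 ∈ η then 1 else 0) ?_ ?_ ?_
  · intro η h
    rw [Finset.mem_filter, Finset.mem_powerset] at h
    rw [Finset.mem_filter]
    refine ⟨Finset.mem_univ _, ?_⟩
    ext v
    rw [key η h.1 v, Pi.zero_apply, ZMod.natCast_eq_zero_iff_even]
    exact h.2 v
  · intro η h η' h' heq
    rw [Finset.mem_filter, Finset.mem_powerset] at h h'
    ext e
    by_cases he : e ∈ ω
    · have := congrFun heq ⟨e, he⟩
      by_cases h1 : e ∈ η <;> by_cases h2 : e ∈ η' <;> simp_all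
    · exact ⟨fun h1 => absurd (h.1 h1) he, fun h1 => absurd (h'.1 h1) he⟩
  · intro f hf
    rw [Finset.mem_filter] at hf
    set η : Finset (Sym2 V) :=
      (Finset.univ.filter (fun e : ω => f e = 1)).map (Function.Embedding.subtype _) with hη
    have hsub : η ⊆ ω := by
      intro e he
      rw [hη, Finset.mem_map] at he
      obtain ⟨a, _, rfl⟩ := he
      exact a.2
    have hfe : (fun e : ω => if e.1 ∈ η then (1 : ZMod 2) else 0) = f := by
      ext e
      have hm : e.1 ∈ η ↔ f e = 1 := by
        simp [hη]
      have h01 : ∀ y : ZMod 2, y = 0 ∨ y = 1 := by decide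
      rcases h01 (f e) with h | h <;> simp [hm, h]
    refine ⟨η, ?_, hfe⟩
    rw [Finset.mem_filter, Finset.mem_powerset]
    refine ⟨hsub, fun v => ?_⟩
    rw [← ZMod.natCast_eq_zero_iff_even, ← key η hsub v, hfe, hf.2, Pi.zero_apply]

/-- In the coupling of the Loop O(1) model with FK-Ising: conditionally on `η' = ω'`,
the configuration `η` is uniform over even subgraphs of `ω'` (all even subgraphs of `ω'`
carry the same joint weight), and the number of even subgraphs of `ω'` is
`2 ^ (|ω'| - |V| + k(ω'))`. -/
theorem stmt14 {V : Type*} [Fintype V] [DecidableEq V] (G : SimpleGraph V)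
    [DecidableRel G.Adj] (x : ℝ) (hx : x ∈ Set.Icc (0 : ℝ) 1) :
    ∀ ω' ∈ G.edgeFinset.powerset,
      (∀ η₁ η₂ : Finset (Sym2 V),
        η₁ ⊆ ω' → (∀ v : V, Even ((η₁.filter fun e => v ∈ e).card)) →
        η₂ ⊆ ω' → (∀ v : V, Even ((η₂.filter fun e => v ∈ e).card)) →
        (∑ X ∈ G.edgeFinset.powerset,
          (if η₁ ∪ X = ω' then
            x ^ η₁.card * (x ^ X.card * (1 - x) ^ (G.edgeFinset.card - X.card))
          else 0))
        = (∑ X ∈ G.edgeFinset.powerset,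
          (if η₂ ∪ X = ω' then
            x ^ η₂.card * (x ^ X.card * (1 - x) ^ (G.edgeFinset.card - X.card))
          else 0))) ∧
      (ω'.powerset.filter
          (fun η => ∀ v : V, Even ((η.filter fun e => v ∈ e).card))).card
        = 2 ^ (ω'.card
            + Nat.card (SimpleGraph.fromEdgeSet (↑ω' : Set (Sym2 V))).ConnectedComponent
            - Fintype.card V) := by
  intro ω' hω'
  rw [Finset.mem_powerset] at hω'
  refine ⟨fun η₁ η₂ h1 _ h2 _ => ?_, ?_⟩
  · rw [aux_weight _ _ _ x hω' h1, aux_weight _ _ _ x hω' h2]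
  · have hd : ∀ e ∈ ω', ¬ e.IsDiag := fun e he =>
      G.not_isDiag_of_mem_edgeSet (SimpleGraph.mem_edgeFinset.1 (hω' he))
    rw [aux_card, ← aux_ker ω' hd, Module.natCard_eq_pow_finrank (K := ZMod 2)]
    simp
end

section
/- Let G be a locally finite infinite graph each of whose connected components is one-ended. Then every bi-infinite simple path in G lies in the closed span (with respect to pointwise convergence on {0,1}^{E(G)}) of the finite cycles of G; consequently the free and wired cycle spaces of G coincide. -/
/-- The edge sets of finite cycles of `G`. -/
def SimpleGraph.cycleEdgeSets {V : Type*} (G : SimpleGraph V) : Set (Set (Sym2 V)) :=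
  {C | ∃ (v : V) (c : G.Walk v v), c.IsCycle ∧ C = {e | e ∈ c.edges}}

/-- Finite ℤ/2-sums (symmetric differences) of members of a family of sets. -/
def finSymmDiffSpan {α : Type*} (𝒞 : Set (Set α)) : Set (Set α) :=
  {H | ∃ l : List (Set α), (∀ C ∈ l, C ∈ 𝒞) ∧ H = l.foldr symmDiff ∅}

/-- Closure with respect to pointwise convergence on `{0,1}^α`. -/
def pointwiseClosure {α : Type*} (S : Set (Set α)) : Set (Set α) :=
  {H | ∀ A : Finset α, ∃ σ ∈ S, ∀ e ∈ A, e ∈ σ ↔ e ∈ H}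

section helpers

open Classical in
/-- Number of edges of `F` at `v`. -/
noncomputable def fdeg {V : Type*} (F : Finset (Sym2 V)) (v : V) : ℕ :=
  (F.filter (fun e => v ∈ e)).card

open Classical in
theorem fdeg_symmDiff {V : Type*} (F F' : Finset (Sym2 V)) (v : V) :
    Even (fdeg (symmDiff F F') v) ↔ (Even (fdeg F v) ↔ Even (fdeg F' v)) := by
  have key : ∀ X Y : Finset (Sym2 V),
      (symmDiff X Y).card + 2 * (X ∩ Y).card = X.card + Y.card := by
    intro X Y
    have h1 := Finset.card_sdiff_add_card_inter X Y
    have h2 := Finset.card_sdiff_add_card_inter Y X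
    have h3 : (symmDiff X Y).card = (X \ Y).card + (Y \ X).card := by
      rw [symmDiff_def]
      exact Finset.card_union_of_disjoint disjoint_sdiff_sdiff
    rw [Finset.inter_comm Y X] at h2
    omega
  have h4 : (symmDiff F F').filter (fun e => v ∈ e)
      = symmDiff (F.filter (fun e => v ∈ e)) (F'.filter (fun e => v ∈ e)) := by
    ext e
    simp only [Finset.mem_filter, Finset.mem_symmDiff]
    tauto
  unfold fdeg
  rw [h4]
  have := key (F.filter (fun e => v ∈ e)) (F'.filter (fun e => v ∈ e))
  rw [← Nat.even_add, ← this, Nat.even_add]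
  simp

open Classical in
theorem fdeg_trail {V : Type*} {G : SimpleGraph V} {u v : V} (p : G.Walk u v) (hp : p.IsTrail)
    (x : V) : Even (fdeg p.edges.toFinset x) ↔ (u ≠ v → x ≠ u ∧ x ≠ v) := by
  rw [← hp.even_countP_edges_iff x]
  unfold fdeg
  rw [show p.edges.toFinset.filter (fun e => x ∈ e)
      = (p.edges.filter (fun e => decide (x ∈ e))).toFinset by ext; simp,
    List.toFinset_card_of_nodup (hp.edges_nodup.filter _),
    List.countP_eq_length_filter]

open Classical in
/-- Handshake lemma within a connected component. -/
theorem exists_other_odd {V : Type*} (G : SimpleGraph V) (F : Finset (Sym2 V))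
    (hF : ∀ e ∈ F, e ∈ G.edgeSet) (u : V) (hu : ¬ Even (fdeg F u)) :
    ∃ v, v ≠ u ∧ G.Reachable u v ∧ ¬ Even (fdeg F v) := by
  by_contra! hcon
  set W : Finset V := (F.biUnion (fun e => e.toFinset)).filter (fun v => G.Reachable u v) with hW
  have hsum : ∑ v ∈ W, fdeg F v = ∑ e ∈ F, (W.filter (fun v => v ∈ e)).card := by
    unfold fdeg
    exact Finset.sum_card_bipartiteAbove_eq_sum_card_bipartiteBelow (fun v e => v ∈ e)
  have heven : Even (∑ e ∈ F, (W.filter (fun v => v ∈ e)).card) := by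
    refine Finset.even_sum _ ?_
    intro e he
    induction e with
    | _ a b =>
    have hab : G.Adj a b := hF _ he
    have ha : a ∈ F.biUnion (fun e => e.toFinset) :=
      Finset.mem_biUnion.2 ⟨_, he, by simp⟩
    have hb : b ∈ F.biUnion (fun e => e.toFinset) :=
      Finset.mem_biUnion.2 ⟨_, he, by simp⟩
    by_cases hr : G.Reachable u a
    · have hr' : G.Reachable u b := hr.trans hab.reachable
      have : W.filter (fun v => v ∈ s(a, b)) = {a, b} := by
        ext x
        simp only [Finset.mem_filter, Sym2.mem_iff, Finset.mem_insert, Finset.mem_singleton]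
        constructor
        · exact fun h => h.2
        · rintro (rfl | rfl)
          · exact ⟨Finset.mem_filter.2 ⟨ha, hr⟩, Or.inl rfl⟩
          · exact ⟨Finset.mem_filter.2 ⟨hb, hr'⟩, Or.inr rfl⟩
      rw [this, Finset.card_pair hab.ne]
      exact even_two
    · have hr' : ¬ G.Reachable u b := fun h => hr (h.trans hab.symm.reachable)
      have : W.filter (fun v => v ∈ s(a, b)) = ∅ := by
        rw [Finset.filter_eq_empty_iff]
        intro x hx hx'
        have hx2 := (Finset.mem_filter.1 hx).2
        rcases Sym2.mem_iff.1 hx' with rfl | rfl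
        · exact hr hx2
        · exact hr' hx2
      rw [this]
      simp
  rw [← hsum] at heven
  have huW : u ∈ W := by
    refine Finset.mem_filter.2 ⟨?_, SimpleGraph.Reachable.refl _⟩
    have : (F.filter (fun e => u ∈ e)).Nonempty := by
      rw [← Finset.card_pos]
      rcases Nat.eq_zero_or_pos (fdeg F u) with h | h
      · exact absurd (h ▸ Even.zero) hu
      · exact h
    obtain ⟨e, he⟩ := this
    rw [Finset.mem_filter] at he
    exact Finset.mem_biUnion.2 ⟨e, he.1, by simpa using he.2⟩
  rw [← Finset.add_sum_erase _ _ huW, Nat.even_add] at heven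
  apply hu
  rw [heven]
  refine Finset.even_sum _ ?_
  intro v hv
  rw [Finset.mem_erase] at hv
  exact hcon v hv.1 (Finset.mem_filter.1 hv.2).2

open Classical in
/-- A finite even edge set is a sum of cycles. -/
theorem even_mem_span {V : Type*} (G : SimpleGraph V) :
    ∀ (n : ℕ) (F : Finset (Sym2 V)), F.card = n → (∀ e ∈ F, e ∈ G.edgeSet) →
      (∀ v, Even (fdeg F v)) → (F : Set (Sym2 V)) ∈ finSymmDiffSpan G.cycleEdgeSets := by
  intro n
  induction n using Nat.strong_induction_on with
  | _ n ih =>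
  intro F hn hF hev
  rcases F.eq_empty_or_nonempty with rfl | ⟨e, he⟩
  · exact ⟨[], by simp, by simp⟩
  induction e with
  | _ a b =>
  have hab : G.Adj a b := hF _ he
  set H : SimpleGraph V := SimpleGraph.fromEdgeSet (F : Set (Sym2 V)) with hH
  have hHG : H ≤ G := by
    intro x y hxy
    rw [hH, SimpleGraph.fromEdgeSet_adj] at hxy
    exact hF _ hxy.1
  have hHab : H.Adj a b := by
    rw [hH, SimpleGraph.fromEdgeSet_adj]
    exact ⟨he, hab.ne⟩
  have hs : ∀ x, Even (fdeg ({s(a, b)} : Finset (Sym2 V)) x) ↔ ¬ (x = a ∨ x = b) := by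
    intro x
    unfold fdeg
    by_cases hx : x = a ∨ x = b
    · rw [Finset.filter_true_of_mem (by simpa using hx)]
      simp [hx]
    · rw [Finset.filter_false_of_mem (by simpa using hx)]
      simp [hx]
  have hd : ∀ x, Even (fdeg (symmDiff F {s(a, b)}) x) ↔ ¬ (x = a ∨ x = b) := by
    intro x
    rw [fdeg_symmDiff, hs]
    simp [hev x]
  have hreach : (H.deleteEdges {s(a, b)}).Reachable a b := by
    obtain ⟨v, hva, hrv, hvo⟩ := exists_other_odd (H.deleteEdges {s(a, b)})
      (symmDiff F {s(a, b)}) (by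
        intro e' he'
        rw [Finset.mem_symmDiff] at he'
        have h1 : e' ∈ F ∧ e' ≠ s(a, b) := by
          rcases he' with h | h
          · simpa using h
          · simp only [Finset.mem_singleton] at h
            exact absurd (h.1 ▸ he) h.2
        rw [SimpleGraph.edgeSet_deleteEdges]
        refine ⟨?_, by simpa using h1.2⟩
        rw [hH, SimpleGraph.edgeSet_fromEdgeSet]
        exact ⟨h1.1, G.not_isDiag_of_mem_edgeSet (hF _ h1.1)⟩) a (by rw [hd]; simp)
    rw [hd] at hvo
    have : v = b := by tauto
    exact this ▸ hrv
  obtain ⟨u, p, hp, hmem⟩ :=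
    SimpleGraph.adj_and_reachable_delete_edges_iff_exists_cycle.1 ⟨hHab, hreach⟩
  have hpF : p.edges.toFinset ⊆ F := by
    intro e' he'
    rw [List.mem_toFinset] at he'
    have := p.edges_subset_edgeSet he'
    rw [hH, SimpleGraph.edgeSet_fromEdgeSet] at this
    exact this.1
  have hC : {e | e ∈ p.edges} ∈ G.cycleEdgeSets := by
    refine ⟨u, p.mapLe hHG, hp.mapLe hHG, ?_⟩
    simp
  have hsub : symmDiff F p.edges.toFinset = F \ p.edges.toFinset := by
    rw [symmDiff_def, Finset.sdiff_eq_empty_iff_subset.2 hpF]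
    simp
  have hlt : (F \ p.edges.toFinset).card < n := by
    rw [← hn]
    apply Finset.card_lt_card
    refine ⟨Finset.sdiff_subset, fun h => ?_⟩
    have := h he
    simp [hmem] at this
  obtain ⟨l, hl, hl2⟩ := ih _ hlt (F \ p.edges.toFinset) rfl
    (fun e h => hF e (Finset.mem_sdiff.1 h).1) (by
      intro v
      rw [← hsub, fdeg_symmDiff, fdeg_trail p hp.isTrail]
      simp [hev v])
  refine ⟨{e | e ∈ p.edges} :: l, ?_, ?_⟩
  · intro C hCm
    rcases List.mem_cons.1 hCm with rfl | h
    · exact hC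
    · exact hl C h
  · rw [List.foldr_cons, ← hl2]
    ext e
    have : e ∈ p.edges → e ∈ F := fun h => hpF (List.mem_toFinset.2 h)
    simp only [Set.mem_symmDiff, Finset.mem_coe, Finset.mem_sdiff, List.mem_toFinset,
      Set.mem_ofPred_eq]
    tauto

open Classical in
/-- Fix parities outside `S` without changing edges that touch `S`. -/
theorem fix_parity {V : Type*} (G : SimpleGraph V) (S : Finset V)
    (hS : ∀ u v, u ∉ S → v ∉ S → G.Reachable u v →
      ∃ p : G.Walk u v, ∀ w ∈ p.support, w ∉ S) :
    ∀ (n : ℕ) (O : Finset V) (F : Finset (Sym2 V)), O.card = n → (∀ e ∈ F, e ∈ G.edgeSet) →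
      (∀ v, ¬ Even (fdeg F v) ↔ v ∈ O) → (∀ v ∈ O, v ∉ S) →
      ∃ σ : Finset (Sym2 V), (∀ e ∈ σ, e ∈ G.edgeSet) ∧ (∀ v, Even (fdeg σ v)) ∧
        ∀ e, (∃ v ∈ S, v ∈ e) → (e ∈ σ ↔ e ∈ F) := by
  intro n
  induction n using Nat.strong_induction_on with
  | _ n ih =>
  intro O F hn hF hO hOS
  rcases O.eq_empty_or_nonempty with rfl | ⟨u, hu⟩
  · exact ⟨F, hF, fun v => by simpa using hO v, fun e _ => Iff.rfl⟩
  obtain ⟨v, hvu, hr, hv⟩ := exists_other_odd G F hF u ((hO u).2 hu)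
  rw [hO] at hv
  obtain ⟨p, hp⟩ := hS u v (hOS u hu) (hOS v hv) hr
  have hq : p.bypass.IsTrail := (p.bypass_isPath).isTrail
  have hqs : ∀ w ∈ p.bypass.support, w ∉ S := fun w hw => hp w (p.support_bypass_subset_support hw)
  obtain ⟨σ, h1, h2, h3⟩ := ih ((O.erase u).erase v).card (by
      rw [← hn]
      exact lt_of_le_of_lt (Finset.card_le_card (Finset.erase_subset _ _))
        (Finset.card_erase_lt_of_mem hu))
    ((O.erase u).erase v) (symmDiff F p.bypass.edges.toFinset) rfl (by
      intro e he
      rw [Finset.mem_symmDiff] at he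
      rcases he with h | h
      · exact hF e h.1
      · exact p.bypass.edges_subset_edgeSet (List.mem_toFinset.1 h.1)) (by
      intro x
      rw [fdeg_symmDiff, fdeg_trail _ hq, Finset.mem_erase, Finset.mem_erase, ← hO x]
      have hxu : x = u → ¬ Even (fdeg F x) := fun h => (hO x).2 (h ▸ hu)
      have hxv : x = v → ¬ Even (fdeg F x) := fun h => (hO x).2 (h ▸ hv)
      have := hvu.symm
      tauto) (by
      intro x hx
      exact hOS x (Finset.mem_of_mem_erase (Finset.mem_of_mem_erase hx)))
  refine ⟨σ, h1, h2, ?_⟩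
  rintro e ⟨w, hwS, hwe⟩
  rw [h3 e ⟨w, hwS, hwe⟩, Finset.mem_symmDiff]
  have : e ∉ p.bypass.edges.toFinset := by
    intro h
    rw [List.mem_toFinset] at h
    exact hqs w (SimpleGraph.Walk.mem_support_of_mem_edges h hwe) hwS
  tauto

open CategoryTheory in
theorem infinite_comp_unique {V : Type*} (X : SimpleGraph V) [X.LocallyFinite]
    [Fact X.Preconnected] (hsub : Subsingleton X.end) (K : Finset V) (C D : X.ComponentCompl K)
    (hC : C.supp.Infinite) (hD : D.supp.Infinite) : C = D := by
  have hinf : Infinite V := Set.infinite_univ_iff.1 (hC.mono (Set.subset_univ _))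
  have hfin : ∀ j, Finite (X.componentComplFunctor.obj j) :=
    fun j => X.componentCompl_finite j.unop
  have hne : ∀ j, Nonempty (X.componentComplFunctor.obj j) :=
    fun j => X.componentCompl_nonempty_of_infinite j.unop
  have hML : X.componentComplFunctor.IsMittagLeffler :=
    X.componentComplFunctor.isMittagLeffler_of_exists_finite_range
      (fun j => ⟨j, 𝟙 j, Set.toFinite _⟩)
  have hne' := fun j => X.componentComplFunctor.toEventualRanges_nonempty hML j
  have hsurj := X.componentComplFunctor.surjective_toEventualRanges hML
  have hev := X.componentComplFunctor.toEventualRanges.eval_section_surjective_of_surjective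
    hsurj (Opposite.op K)
  have hC' := (X.infinite_iff_in_eventualRange (K := Opposite.op K) C).1 hC
  have hD' := (X.infinite_iff_in_eventualRange (K := Opposite.op K) D).1 hD
  obtain ⟨s, hs⟩ := hev ⟨C, hC'⟩
  obtain ⟨t, ht⟩ := hev ⟨D, hD'⟩
  have hst : s = t := X.componentComplFunctor.toEventualRangesSectionsEquiv.injective
    (@Subsingleton.elim _ hsub _ _)
  subst hst
  exact congrArg Subtype.val (hs.symm.trans ht)

theorem walk_of_induce {V : Type*} {G : SimpleGraph V} {s : Set V} {a b : s}
    (p : (G.induce s).Walk a b) :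
    ∃ q : G.Walk a.1 b.1, ∀ w ∈ q.support, ∃ w' : s, w' ∈ p.support ∧ w'.1 = w := by
  induction p with
  | nil => exact ⟨SimpleGraph.Walk.nil, by simp⟩
  | @cons x y z h p ih =>
    obtain ⟨q, hq⟩ := ih
    have h' : G.Adj x.1 y.1 := h
    refine ⟨SimpleGraph.Walk.cons h' q, fun w hw => ?_⟩
    rw [SimpleGraph.Walk.support_cons, List.mem_cons] at hw
    rcases hw with rfl | hw
    · exact ⟨x, by simp, rfl⟩
    · obtain ⟨w', h1, h2⟩ := hq w hw
      exact ⟨w', by simp [h1], h2⟩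

open Classical in
theorem one_end_comp {V : Type*} (X : SimpleGraph V) [X.LocallyFinite]
    [Fact X.Preconnected] (hsub : Subsingleton X.end) (K : Finset V) :
    ∃ S : Set V, S.Finite ∧ (K : Set V) ⊆ S ∧ ∀ u v, u ∉ S → v ∉ S →
      ∃ p : X.Walk u v, ∀ w ∈ p.support, w ∉ S := by
  refine ⟨K ∪ ⋃ C : {C : X.ComponentCompl K // C.supp.Finite}, C.1.supp, ?_,
    Set.subset_union_left, ?_⟩
  · exact K.finite_toSet.union (Set.finite_iUnion (fun C => C.2))
  intro u v hu hv
  have hK : ∀ w, w ∉ (K ∪ ⋃ C : {C : X.ComponentCompl K // C.supp.Finite}, C.1.supp : Set V) ↔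
      ∃ h : w ∉ (K : Set V), (X.componentComplMk h).supp.Infinite := by
    intro w
    simp only [Set.mem_union, Set.mem_iUnion, not_or, not_exists]
    constructor
    · rintro ⟨h1, h2⟩
      exact ⟨h1, fun hf => h2 ⟨_, hf⟩ ⟨h1, rfl⟩⟩
    · rintro ⟨h1, h2⟩
      refine ⟨h1, ?_⟩
      rintro ⟨C, hC⟩ ⟨h3, h4⟩
      exact h2 (by rw [h4]; exact hC)
  obtain ⟨hu1, hu2⟩ := (hK u).1 hu
  obtain ⟨hv1, hv2⟩ := (hK v).1 hv
  have heq := infinite_comp_unique X hsub K _ _ hu2 hv2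
  obtain ⟨p⟩ := SimpleGraph.ConnectedComponent.eq.1 heq
  obtain ⟨q, hq⟩ := walk_of_induce p
  refine ⟨q, ?_⟩
  intro w hw
  obtain ⟨w', hw', rfl⟩ := hq w hw
  refine (hK _).2 ⟨w'.2, ?_⟩
  have : X.componentComplMk w'.2 = X.componentComplMk hu1 :=
    SimpleGraph.ConnectedComponent.eq.2 ⟨(p.takeUntil w' hw').reverse⟩
  exact this ▸ hu2

open Classical in
theorem exists_good_set {V : Type*} (G : SimpleGraph V) (hlf : G.LocallyFinite)
    (hone : ∀ c : G.ConnectedComponent,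
      Nat.card (SimpleGraph.end (G.induce c.supp)) = 1) (A : Finset V) :
    ∃ S : Finset V, A ⊆ S ∧ ∀ u v, u ∉ S → v ∉ S → G.Reachable u v →
      ∃ p : G.Walk u v, ∀ w ∈ p.support, w ∉ S := by
  have hex : ∀ c : G.ConnectedComponent, ∃ S : Set c.supp, S.Finite ∧
      (∀ x : c.supp, x.1 ∈ A → x ∈ S) ∧ ∀ u v, u ∉ S → v ∉ S →
      ∃ p : (G.induce c.supp).Walk u v, ∀ w ∈ p.support, w ∉ S := by
    intro c
    have h1 : (G.induce c.supp).LocallyFinite := by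
      intro v
      have : Finite ((G.induce c.supp).neighborSet v) := by
        have := hlf v.1
        refine Finite.of_injective
          (fun x : (G.induce c.supp).neighborSet v =>
            (⟨x.1.1, x.2⟩ : G.neighborSet v.1)) ?_
        intro x y hxy
        exact Subtype.ext (Subtype.ext (Subtype.mk.inj hxy))
      exact Fintype.ofFinite _
    have h2 : Fact (G.induce c.supp).Preconnected := ⟨c.connected_toSimpleGraph.preconnected⟩
    have h3 : Subsingleton (G.induce c.supp).end :=
      (Nat.card_eq_one_iff_unique.1 (hone c)).1
    obtain ⟨S, hS1, hS2, hS3⟩ := one_end_comp (G.induce c.supp) h3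
      (A.preimage Subtype.val Subtype.val_injective.injOn)
    exact ⟨S, hS1, fun x hx => hS2 (by simpa using hx), hS3⟩
  choose T hT1 hT2 hT3 using hex
  set S : Finset V := (A.image G.connectedComponentMk).biUnion
    (fun c => ((hT1 c).toFinset).image Subtype.val) with hSdef
  have hmem : ∀ w, w ∈ S ↔ (∃ a ∈ A, G.connectedComponentMk a = G.connectedComponentMk w) ∧
      (⟨w, rfl⟩ : (G.connectedComponentMk w).supp) ∈ T (G.connectedComponentMk w) := by
    intro w
    rw [hSdef]
    simp only [Finset.mem_biUnion, Finset.mem_image, Set.Finite.mem_toFinset]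
    constructor
    · rintro ⟨c, hc, ⟨x, hx⟩, hxT, rfl⟩
      have : G.connectedComponentMk x = c := hx
      subst this
      exact ⟨hc, hxT⟩
    · rintro ⟨h1, h2⟩
      exact ⟨_, h1, _, h2, rfl⟩
  refine ⟨S, ?_, ?_⟩
  · intro a ha
    exact (hmem a).2 ⟨⟨a, ha, rfl⟩, hT2 _ _ ha⟩
  intro u v hu hv hr
  by_cases hA : ∃ a ∈ A, G.connectedComponentMk a = G.connectedComponentMk u
  · have hc : G.connectedComponentMk v = G.connectedComponentMk u :=
      SimpleGraph.ConnectedComponent.eq.2 hr.symm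
    have key : ∀ w (hw : G.connectedComponentMk w = G.connectedComponentMk u),
        w ∉ S ↔ (⟨w, hw⟩ : (G.connectedComponentMk u).supp) ∉ T (G.connectedComponentMk u) := by
      intro w hw
      generalize G.connectedComponentMk u = c at hw hA
      subst hw
      rw [hmem]
      exact ⟨fun h h' => h ⟨hA, h'⟩, fun h h' => h h'.2⟩
    obtain ⟨p, hp⟩ := hT3 (G.connectedComponentMk u) ⟨u, rfl⟩ ⟨v, hc⟩
      ((key u rfl).1 hu) ((key v hc).1 hv)
    obtain ⟨q, hq⟩ := walk_of_induce p
    refine ⟨q, ?_⟩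
    intro w hw
    obtain ⟨w', hw', rfl⟩ := hq w hw
    exact (key _ w'.2).2 (hp w' hw')
  · obtain ⟨p⟩ := hr
    refine ⟨p, fun w hw hwS => hA ?_⟩
    obtain ⟨a, ha, h⟩ := ((hmem w).1 hwS).1
    exact ⟨a, ha, h.trans (SimpleGraph.ConnectedComponent.eq.2 ⟨(p.takeUntil w hw).reverse⟩)⟩

theorem fdeg_eq_ncard {V : Type*} (F : Finset (Sym2 V)) (v : V) :
    fdeg F v = {e ∈ (F : Set (Sym2 V)) | v ∈ e}.ncard := by
  classical
  unfold fdeg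
  rw [← Set.ncard_coe_finset]
  congr 1
  ext e
  simp

open Classical in
theorem wired_sub {V : Type*} (G : SimpleGraph V) (hlf : G.LocallyFinite)
    (hone : ∀ c : G.ConnectedComponent,
      Nat.card (SimpleGraph.end (G.induce c.supp)) = 1) (H : Set (Sym2 V))
    (hH : H ⊆ G.edgeSet) (hev : ∀ v : V, Even {e ∈ H | v ∈ e}.ncard) :
    H ∈ pointwiseClosure (finSymmDiffSpan G.cycleEdgeSets) := by
  intro A
  obtain ⟨S, hAS, hS⟩ := exists_good_set G hlf hone (A.biUnion (fun e => e.toFinset))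
  have hfin : {e ∈ H | ∃ v ∈ S, v ∈ e}.Finite := by
    refine Set.Finite.subset (S.finite_toSet.biUnion
      (fun v _ => (Set.toFinite (G.incidenceSet v)))) ?_
    rintro e ⟨he, v, hv, hve⟩
    exact Set.mem_biUnion (Finset.mem_coe.2 hv) ⟨hH he, hve⟩
  set F := hfin.toFinset with hFdef
  have hF : ∀ e, e ∈ F ↔ e ∈ H ∧ ∃ v ∈ S, v ∈ e := by
    intro e
    rw [hFdef, Set.Finite.mem_toFinset]
    rfl
  have hFS : ∀ v ∈ S, Even (fdeg F v) := by
    intro v hv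
    rw [fdeg_eq_ncard]
    convert hev v using 3
    ext e
    constructor
    · rintro ⟨h1, h2⟩
      exact ⟨((hF e).1 h1).1, h2⟩
    · rintro ⟨h1, h2⟩
      exact ⟨(hF e).2 ⟨h1, v, hv, h2⟩, h2⟩
  obtain ⟨σ, h1, h2, h3⟩ := fix_parity G S hS _
    ((F.biUnion (fun e => e.toFinset)).filter (fun v => ¬ Even (fdeg F v))) F rfl
    (fun e he => hH ((hF e).1 he).1) (by
      intro v
      rw [Finset.mem_filter, iff_and_self]
      intro hv
      obtain ⟨e, he⟩ : (F.filter (fun e => v ∈ e)).Nonempty := by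
        rw [← Finset.card_pos]
        rcases Nat.eq_zero_or_pos (fdeg F v) with h | h
        · exact absurd (h ▸ Even.zero) hv
        · exact h
      rw [Finset.mem_filter] at he
      exact Finset.mem_biUnion.2 ⟨e, he.1, by simpa using he.2⟩) (by
      intro v hv hvS
      exact (Finset.mem_filter.1 hv).2 (hFS v hvS))
  refine ⟨σ, even_mem_span G _ σ rfl h1 h2, ?_⟩
  intro e he
  have ht : ∃ v ∈ S, v ∈ e := by
    induction e with
    | _ a b =>
    exact ⟨a, hAS (Finset.mem_biUnion.2 ⟨_, he, by simp⟩), by simp⟩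
  rw [Finset.mem_coe, h3 e ht, hF]
  tauto

open Classical in
theorem span_even {V : Type*} (G : SimpleGraph V) (σ : Set (Sym2 V))
    (hσ : σ ∈ finSymmDiffSpan G.cycleEdgeSets) :
    ∃ F : Finset (Sym2 V), (F : Set (Sym2 V)) = σ ∧ (∀ e ∈ F, e ∈ G.edgeSet) ∧
      ∀ v, Even (fdeg F v) := by
  obtain ⟨l, hl, rfl⟩ := hσ
  induction l with
  | nil => exact ⟨∅, by simp, by simp, by simp [fdeg]⟩
  | cons C l ih =>
    obtain ⟨F, h1, h2, h3⟩ := ih (fun D hD => hl D (List.mem_cons_of_mem _ hD))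
    obtain ⟨v, c, hc, hC⟩ := hl C List.mem_cons_self
    refine ⟨symmDiff c.edges.toFinset F, ?_, ?_, ?_⟩
    · rw [List.foldr_cons, ← h1, hC, Finset.coe_symmDiff]
      congr 1
      ext e
      simp
    · intro e he
      rw [Finset.mem_symmDiff] at he
      rcases he with h | h
      · exact c.edges_subset_edgeSet (List.mem_toFinset.1 h.1)
      · exact h2 e h.1
    · intro x
      rw [fdeg_symmDiff, fdeg_trail c hc.isTrail]
      simp [h3 x]

theorem closure_sub {V : Type*} (G : SimpleGraph V) (hlf : G.LocallyFinite)
    (H : Set (Sym2 V)) (hH : H ∈ pointwiseClosure (finSymmDiffSpan G.cycleEdgeSets)) :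
    H ⊆ G.edgeSet ∧ ∀ v : V, Even {e ∈ H | v ∈ e}.ncard := by
  classical
  have hsub : H ⊆ G.edgeSet := by
    intro e he
    obtain ⟨σ, hσ, h⟩ := hH {e}
    obtain ⟨F, rfl, h2, -⟩ := span_even G σ hσ
    exact h2 e ((h e (by simp)).2 he)
  refine ⟨hsub, fun v => ?_⟩
  have hfin : (G.incidenceSet v).Finite := Set.toFinite _
  obtain ⟨σ, hσ, h⟩ := hH hfin.toFinset
  obtain ⟨F, rfl, h2, h3⟩ := span_even G σ hσ
  have := h3 v
  rw [fdeg_eq_ncard] at this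
  convert this using 3
  ext e
  constructor
  · rintro ⟨h4, h5⟩
    exact ⟨(h e (by simpa using ⟨hsub h4, h5⟩)).2 h4, h5⟩
  · rintro ⟨h4, h5⟩
    exact ⟨(h e (by simpa using ⟨h2 e h4, h5⟩)).1 h4, h5⟩

theorem biinf_even {V : Type*} (f : ℤ → V) (hf : Function.Injective f) (v : V) :
    Even {e ∈ {e : Sym2 V | ∃ n : ℤ, e = s(f n, f (n + 1))} | v ∈ e}.ncard := by
  by_cases hv : ∃ m, f m = v
  · obtain ⟨m, rfl⟩ := hv
    have : {e ∈ {e : Sym2 V | ∃ n : ℤ, e = s(f n, f (n + 1))} | f m ∈ e}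
        = {s(f m, f (m + 1)), s(f (m - 1), f m)} := by
      ext e
      simp only [Set.mem_ofPred_eq, Set.mem_insert_iff, Set.mem_singleton_iff]
      constructor
      · rintro ⟨⟨n, rfl⟩, h⟩
        rcases Sym2.mem_iff.1 h with h | h
        · rw [hf h]; exact Or.inl rfl
        · have := hf h
          subst this
          right; simp
      · rintro (rfl | rfl)
        · exact ⟨⟨m, rfl⟩, by simp⟩
        · exact ⟨⟨m - 1, by simp⟩, by simp⟩
    rw [this, Set.ncard_pair]
    · exact even_two
    · intro h
      rw [Sym2.eq_iff] at h
      rcases h with h | h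
      · have := hf h.1; omega
      · have := hf h.2; omega
  · have : {e ∈ {e : Sym2 V | ∃ n : ℤ, e = s(f n, f (n + 1))} | v ∈ e} = ∅ := by
      ext e
      simp only [Set.mem_ofPred_eq, Set.mem_empty_iff_false, iff_false]
      rintro ⟨⟨n, rfl⟩, h⟩
      rcases Sym2.mem_iff.1 h with h | h
      · exact hv ⟨_, h.symm⟩
      · exact hv ⟨_, h.symm⟩
    rw [this]
    simp

end helpers

theorem stmt17 {V : Type*} (G : SimpleGraph V) (hlf : G.LocallyFinite)
    (hone : ∀ c : G.ConnectedComponent,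
      Nat.card (SimpleGraph.end (G.induce c.supp)) = 1) :
    (∀ f : ℤ → V, Function.Injective f → (∀ n : ℤ, G.Adj (f n) (f (n + 1))) →
      {e : Sym2 V | ∃ n : ℤ, e = s(f n, f (n + 1))} ∈
        pointwiseClosure (finSymmDiffSpan G.cycleEdgeSets)) ∧
    {H : Set (Sym2 V) | H ⊆ G.edgeSet ∧ ∀ v : V, Even {e ∈ H | v ∈ e}.ncard}
      = pointwiseClosure (finSymmDiffSpan G.cycleEdgeSets) := by
  refine ⟨?_, ?_⟩
  · intro f hf hadj
    refine wired_sub G hlf hone _ ?_ (biinf_even f hf)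
    rintro e ⟨n, rfl⟩
    exact hadj n
  · ext H
    exact ⟨fun h => wired_sub G hlf hone H h.1 h.2, fun h => closure_sub G hlf H h⟩
end
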